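/- Let s ≥ 2 and let (x_n)_{n≥0} be the s-dimensional generalized Halton sequence in rational bases (u_1/v_1,…,u_s/v_s). Set u_0 = max_{1≤i≤s} u_i and C = 1/(2^{s+2}·s^s·u_1⋯u_s·u_0^{s²+s}·(log u_0)^s). Then for every integer N > u_0^{4s·u_0^{s+1}·u_1⋯u_s}, with t = max_{1≤i≤s} ⌈log_{u_i} N⌉, one has sup_{1≤M≤N} M·D*_M(([x_n]_t)_{n≥0}) ≥ (C/2)·(log N)^s, where [x_n]_t denotes the coordinatewise truncation ([x_n^{(1)}]_t,…,[x_n^{(s)}]_t). -/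

import Mathlib

open Finset

/-- The auxiliary integers `z_r` in the formal `u/v`-adic expansion of an integer `z`:
`z_0 = z` and `z_{r+1} = (v·z_r − a_{r+1})/u`, where `a_{r+1} = (v·z_r) mod u` is the unique
element of `{0,…,u−1}` with `u ∣ (v·z_r − a_{r+1})`. -/
def ratZ (u v : ℕ) (z : ℤ) : ℕ → ℤ
  | 0 => z
  | r + 1 => ((v : ℤ) * ratZ u v z r - ((v : ℤ) * ratZ u v z r) % (u : ℤ)) / (u : ℤ)

/-- `ratDigit u v z r` is the digit `a_{r+1}` of the formal `u/v`-adic expansion of `z`,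
i.e. the unique element of `{0,…,u−1}` with `u ∣ (v·z_r − a_{r+1})`. -/
def ratDigit (u v : ℕ) (z : ℤ) (r : ℕ) : ℕ :=
  (((v : ℤ) * ratZ u v z r) % (u : ℤ)).toNat

/-- The generalized `u/v`-adic radical inverse function
`φ^Σ_{u/v}(n) = Σ_{r≥1} σ_r(a_r)/u^r`, where `σ r` is the permutation `σ_{r+1}` of
`{0,…,u−1}` and `a_{r+1} = ratDigit u v n r`. -/
noncomputable def ratPhi (u v : ℕ) (σ : ℕ → ℕ → ℕ) (n : ℕ) : ℝ :=
  ∑' r : ℕ, (σ r (ratDigit u v (n : ℤ) r) : ℝ) / (u : ℝ) ^ (r + 1)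

/-- The truncation `[φ^Σ_{u/v}(n)]_t = Σ_{r=1}^t σ_r(a_r)/u^r` of the generalized
`u/v`-adic radical inverse function to its first `t` prescribed digits. -/
noncomputable def ratPhiTrunc (u v : ℕ) (σ : ℕ → ℕ → ℕ) (t n : ℕ) : ℝ :=
  ∑ r ∈ Finset.range t, (σ r (ratDigit u v (n : ℤ) r) : ℝ) / (u : ℝ) ^ (r + 1)

/-- The star discrepancy `D*_N` of the first `N` points of the sequence `x` in `[0,1]^s`:
`D*_N = sup_{y ∈ (0,1]^s} |#{0 ≤ n < N : x_n^{(i)} < y^{(i)}, i=1,…,s}/N − Π_i y^{(i)}|`. -/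
noncomputable def starDisc (s N : ℕ) (x : ℕ → Fin s → ℝ) : ℝ :=
  sSup { d : ℝ | ∃ y : Fin s → ℝ, (∀ i, y i ∈ Set.Ioc (0 : ℝ) 1) ∧
    d = |(Nat.card {n : ℕ | n < N ∧ ∀ i, x n i < y i} : ℝ) / N - ∏ i, y i| }

/-- Base-`u` number whose digits, most significant first, are `d 0, …, d (t - 1)`. -/
def digitNum (u : ℕ) (d : ℕ → ℕ) : ℕ → ℕ
  | 0 => 0
  | t + 1 => u * digitNum u d t + d t

lemma sum_digits_eq_digitNum_div {u : ℕ} (hu : 0 < u) (d : ℕ → ℕ) (t : ℕ) :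
    ∑ r ∈ Finset.range t, (d r : ℝ) / (u : ℝ) ^ (r + 1) = (digitNum u d t : ℝ) / (u : ℝ) ^ t := by
  have hu' : (u : ℝ) ≠ 0 := by positivity
  induction t with
  | zero => simp [digitNum]
  | succ t ih =>
    rw [Finset.sum_range_succ, ih, digitNum]
    push_cast
    field_simp
    ring

lemma mul_add_lt_mul_add_iff {u a b x y : ℕ} (hx : x < u) (hy : y < u) :
    u * a + x < u * b + y ↔ a < b ∨ (a = b ∧ x < y) := by
  rcases lt_trichotomy a b with h | h | h
  · have : u * (a + 1) ≤ u * b := Nat.mul_le_mul_left u h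
    simp only [h, true_or, iff_true]
    nlinarith
  · subst h
    simp
  · have : u * (b + 1) ≤ u * a := Nat.mul_le_mul_left u h
    constructor
    · intro h'
      nlinarith
    · omega

lemma mul_add_eq_mul_add_iff {u a b x y : ℕ} (hx : x < u) (hy : y < u) :
    u * a + x = u * b + y ↔ a = b ∧ x = y := by
  have h1 := mul_add_lt_mul_add_iff (a := a) (b := b) hx hy
  have h2 := mul_add_lt_mul_add_iff (a := b) (b := a) hy hx
  constructor
  · intro h
    omega
  · rintro ⟨rfl, rfl⟩
    rfl

lemma digitNum_eq_iff {u : ℕ} {d e : ℕ → ℕ} (hd : ∀ r, d r < u) (he : ∀ r, e r < u) (t : ℕ) :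
    digitNum u d t = digitNum u e t ↔ ∀ j < t, d j = e j := by
  induction t with
  | zero => simp [digitNum]
  | succ t ih =>
    rw [digitNum, digitNum, mul_add_eq_mul_add_iff (hd t) (he t), ih, Nat.forall_lt_succ_right]

lemma digitNum_lt_iff {u : ℕ} {d e : ℕ → ℕ} (hd : ∀ r, d r < u) (he : ∀ r, e r < u) (t : ℕ) :
    digitNum u d t < digitNum u e t ↔ ∃ r < t, d r < e r ∧ ∀ j < r, d j = e j := by
  induction t with
  | zero => simp [digitNum]
  | succ t ih =>
    rw [digitNum, digitNum, mul_add_lt_mul_add_iff (hd t) (he t), ih,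
      digitNum_eq_iff hd he, Nat.exists_lt_succ_right, and_comm (a := d t < e t)]

lemma digitNum_lt_pow {u : ℕ} {d : ℕ → ℕ} (hd : ∀ r, d r < u) (t : ℕ) :
    digitNum u d t < u ^ t := by
  induction t with
  | zero => simp [digitNum]
  | succ t ih =>
    rw [digitNum, pow_succ]
    have := hd t
    nlinarith

lemma sum_digits_lt_iff {u : ℕ} (hu : 0 < u) {d e : ℕ → ℕ}
    (hd : ∀ r, d r < u) (he : ∀ r, e r < u) (t : ℕ) :
    ∑ r ∈ Finset.range t, (d r : ℝ) / (u : ℝ) ^ (r + 1) <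
        ∑ r ∈ Finset.range t, (e r : ℝ) / (u : ℝ) ^ (r + 1) ↔
      ∃ r < t, d r < e r ∧ ∀ j < r, d j = e j := by
  rw [sum_digits_eq_digitNum_div hu, sum_digits_eq_digitNum_div hu,
    div_lt_div_iff_of_pos_right (by positivity), Nat.cast_lt, digitNum_lt_iff hd he]

lemma sum_digits_le_one {u : ℕ} (hu : 0 < u) {d : ℕ → ℕ} (hd : ∀ r, d r < u) (t : ℕ) :
    ∑ r ∈ Finset.range t, (d r : ℝ) / (u : ℝ) ^ (r + 1) ≤ 1 := by
  rw [sum_digits_eq_digitNum_div hu, div_le_one (by positivity)]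
  exact_mod_cast (digitNum_lt_pow hd t).le

section RationalDigits

variable {u v : ℕ}

lemma natCast_ratDigit (hu : 0 < u) (z : ℤ) (r : ℕ) :
    (ratDigit u v z r : ℤ) = ((v : ℤ) * ratZ u v z r) % (u : ℤ) :=
  Int.toNat_of_nonneg (Int.emod_nonneg _ (by positivity))

lemma ratDigit_lt (hu : 0 < u) (z : ℤ) (r : ℕ) : ratDigit u v z r < u := by
  have h := natCast_ratDigit (v := v) hu z r
  have := Int.emod_lt_of_pos ((v : ℤ) * ratZ u v z r) (b := (u : ℤ)) (by positivity)
  omega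

lemma mul_ratZ_succ (z : ℤ) (r : ℕ) :
    (u : ℤ) * ratZ u v z (r + 1) = v * ratZ u v z r - (v * ratZ u v z r) % u := by
  rw [ratZ]
  exact Int.mul_ediv_cancel' (Int.dvd_self_sub_emod)

lemma ratZ_sub_ratZ (hu : 0 < u) {z z' w : ℤ} {r : ℕ} (h : z - z' = u ^ r * w) :
    ratZ u v z r - ratZ u v z' r = v ^ r * w := by
  induction r generalizing w with
  | zero => simpa [ratZ] using h
  | succ r ih =>
    have h1 := ih (w := u * w) (by rw [h]; ring)
    have h2 := mul_ratZ_succ (u := u) (v := v) z r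
    have h3 := mul_ratZ_succ (u := u) (v := v) z' r
    have h4 : (v * ratZ u v z r) % (u : ℤ) = (v * ratZ u v z' r) % u := by
      apply Int.ModEq.eq
      apply Int.ModEq.symm
      rw [Int.modEq_iff_dvd]
      exact ⟨v ^ (r + 1) * w, by linear_combination v * h1⟩
    have hu' : (u : ℤ) ≠ 0 := by positivity
    apply mul_left_cancel₀ hu'
    linear_combination h2 - h3 - h4 + v * h1

lemma ratDigit_modEq (hu : 0 < u) {z z' w : ℤ} {r : ℕ} (h : z - z' = u ^ r * w) :
    (ratDigit u v z r : ℤ) ≡ ratDigit u v z' r + v ^ (r + 1) * w [ZMOD u] := by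
  have h1 := ratZ_sub_ratZ (v := v) hu h
  rw [natCast_ratDigit hu, natCast_ratDigit hu]
  have h2 : (v : ℤ) * ratZ u v z r = v * ratZ u v z' r + v ^ (r + 1) * w := by
    linear_combination v * h1
  rw [h2]
  exact (Int.mod_modEq _ _).trans ((Int.mod_modEq _ _).symm.add_right _)

lemma ratDigit_eq_iff_modEq (hu : 0 < u) (z z' : ℤ) (r : ℕ) :
    ratDigit u v z r = ratDigit u v z' r ↔
      (ratDigit u v z r : ℤ) ≡ ratDigit u v z' r [ZMOD u] := by
  constructor
  · intro h
    rw [h]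
  · intro h
    rw [Int.natCast_modEq_iff] at h
    exact Nat.ModEq.eq_of_lt_of_lt h (ratDigit_lt hu z r) (ratDigit_lt hu z' r)

lemma isCoprime_pow (huv : Nat.Coprime u v) (r : ℕ) : IsCoprime (u : ℤ) ((v : ℤ) ^ r) :=
  (Nat.isCoprime_iff_coprime.mpr huv).pow_right

lemma forall_ratDigit_eq_iff (hu : 0 < u) (huv : Nat.Coprime u v) (z z' : ℤ) (r : ℕ) :
    (∀ j < r, ratDigit u v z j = ratDigit u v z' j) ↔ (u : ℤ) ^ r ∣ z - z' := by
  induction r with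
  | zero => simp
  | succ r ih =>
    rw [Nat.forall_lt_succ_right, ih]
    constructor
    · rintro ⟨⟨w, hw⟩, h⟩
      have h1 := ratDigit_modEq (v := v) hu hw
      rw [h] at h1
      have h2 : (u : ℤ) ∣ v ^ (r + 1) * w := by
        have := (Int.modEq_iff_dvd.mp h1)
        simpa using this
      obtain ⟨c, hc⟩ := (isCoprime_pow huv (r + 1)).dvd_of_dvd_mul_left h2
      exact ⟨c, by rw [hw, hc]; ring⟩
    · rintro ⟨w, hw⟩
      have hw' : z - z' = u ^ r * (u * w) := by rw [hw]; ring
      refine ⟨⟨_, hw'⟩, ?_⟩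
      rw [ratDigit_eq_iff_modEq hu]
      refine (ratDigit_modEq hu hw').trans (Int.modEq_iff_dvd.mpr ⟨-(v ^ (r + 1) * w), by ring⟩)

lemma exists_pow_mul_modEq (huv : Nat.Coprime u v) (r : ℕ) (a : ℤ) :
    ∃ w : ℤ, v ^ r * w ≡ a [ZMOD u] := by
  obtain ⟨x, y, h⟩ := isCoprime_pow huv r
  exact ⟨y * a, Int.modEq_iff_dvd.mpr ⟨x * a, by linear_combination -a * h⟩⟩

lemma exists_forall_ratDigit_eq (hu : 0 < u) (huv : Nat.Coprime u v) {d : ℕ → ℕ}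
    (hd : ∀ r, d r < u) (r : ℕ) : ∃ z : ℤ, ∀ j < r, ratDigit u v z j = d j := by
  induction r with
  | zero => simp
  | succ r ih =>
    obtain ⟨z, hz⟩ := ih
    obtain ⟨w, hw⟩ := exists_pow_mul_modEq huv (r + 1) (d r - ratDigit u v z r)
    have hzw : (z + u ^ r * w) - z = u ^ r * w := by ring
    refine ⟨z + u ^ r * w, fun j hj => ?_⟩
    rcases Nat.lt_succ_iff_lt_or_eq.mp hj with hj | rfl
    · rw [(forall_ratDigit_eq_iff hu huv _ _ r).mpr ⟨w, hzw⟩ j hj, hz j hj]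
    · have h1 := (ratDigit_modEq (v := v) hu hzw).trans (hw.add_left _)
      rw [add_sub_cancel, Int.natCast_modEq_iff] at h1
      exact Nat.ModEq.eq_of_lt_of_lt h1 (ratDigit_lt hu _ _) (hd j)

/-- Prescribing `r` digits as those of `z'`, and changing the next one from `b` to `a`, amounts to
a congruence modulo `u ^ (r + 1)`. -/
lemma ratDigit_initial_segment_iff (hu : 0 < u) (huv : Nat.Coprime u v) {z z' c : ℤ} {r a b : ℕ}
    (ha : a < u) (hb : ratDigit u v z' r = b) (hc : v ^ (r + 1) * c ≡ (a : ℤ) - b [ZMOD u]) :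
    ((∀ j < r, ratDigit u v z j = ratDigit u v z' j) ∧ ratDigit u v z r = a) ↔
      (u : ℤ) ^ (r + 1) ∣ z - z' - c * u ^ r := by
  have hz : z' + c * u ^ r - z' = u ^ r * c := by ring
  have h0 : ∀ j < r, ratDigit u v (z' + c * u ^ r) j = ratDigit u v z' j :=
    (forall_ratDigit_eq_iff hu huv _ _ r).mpr ⟨c, hz⟩
  have h1 : ratDigit u v (z' + c * u ^ r) r = a := by
    have h := (ratDigit_modEq (v := v) hu hz).trans (hc.add_left _)
    rw [hb, add_sub_cancel, Int.natCast_modEq_iff] at h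
    exact Nat.ModEq.eq_of_lt_of_lt h (ratDigit_lt hu _ _) ha
  rw [sub_sub, ← forall_ratDigit_eq_iff hu huv, Nat.forall_lt_succ_right, h1]
  refine and_congr_left fun _ => forall₂_congr fun j hj => ?_
  rw [h0 j hj]

end RationalDigits

section Counting

lemma count_modEq_sub_div {q a : ℕ} (hq : 0 < q) (ha : a < q) (M : ℕ) :
    (Nat.count (· ≡ a [MOD q]) M : ℝ) - (M : ℝ) / q =
      (if a < M % q then 1 else 0) - ((M % q : ℕ) : ℝ) / q := by
  rw [Nat.count_modEq_card M hq a, Nat.mod_eq_of_lt ha]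
  have hq' : (q : ℝ) ≠ 0 := by positivity
  have h : (M : ℝ) = q * (M / q : ℕ) + (M % q : ℕ) := by exact_mod_cast (Nat.div_add_mod M q).symm
  rw [div_eq_iff hq' |>.mpr (show (M : ℝ) = ((M / q : ℕ) + ((M % q : ℕ) : ℝ) / q) * q by
    rw [add_mul, div_mul_cancel₀ _ hq', mul_comm]; exact h)]
  push_cast
  ring

lemma sum_range_mul_mod (f : ℕ → ℝ) (q l : ℕ) :
    ∑ M ∈ Finset.range (q * l), f (M % q) = l * ∑ M ∈ Finset.range q, f M := by
  induction l with
  | zero => simp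
  | succ l ih =>
    rw [mul_add_one, Finset.sum_range_add, ih]
    have : ∀ M ∈ Finset.range q, f ((q * l + M) % q) = f M := fun M hM => by
      rw [Nat.mul_add_mod, Nat.mod_eq_of_lt (Finset.mem_range.mp hM)]
    rw [Finset.sum_congr rfl this]
    push_cast
    ring

/-- The mean over a full period of the local discrepancy of a residue class. -/
lemma sum_range_count_modEq_sub_div {q a P : ℕ} (hq : 0 < q) (ha : a < q) (hP : q ∣ P) :
    ∑ M ∈ Finset.range P, ((Nat.count (· ≡ a [MOD q]) M : ℝ) - (M : ℝ) / q) =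
      P * (1 / 2 - (a : ℝ) / q - 1 / (2 * q)) := by
  obtain ⟨l, rfl⟩ := hP
  have hq' : (q : ℝ) ≠ 0 := by positivity
  simp_rw [count_modEq_sub_div hq ha]
  rw [sum_range_mul_mod (fun m => (if a < m then 1 else 0) - (m : ℝ) / q), Finset.sum_sub_distrib,
    ← Finset.sum_div]
  have h1 : ∑ m ∈ Finset.range q, (if a < m then (1 : ℝ) else 0) = q - 1 - a := by
    rw [Finset.sum_boole]
    have : {m ∈ Finset.range q | a < m} = Finset.Ioo a q := by
      ext m
      simp [and_comm]
    rw [this, Nat.card_Ioo, Nat.sub_sub, Nat.cast_sub (by omega)]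
    push_cast
    ring
  have h2 : ∑ m ∈ Finset.range q, (m : ℝ) = q * (q - 1) / 2 := by
    have := Finset.sum_range_id_mul_two q
    have h3 : ((∑ m ∈ Finset.range q, m : ℕ) : ℝ) * 2 = q * ((q - 1 : ℕ) : ℝ) := by
      exact_mod_cast this
    rw [Nat.cast_sub hq] at h3
    push_cast at h3
    linarith
  rw [h1, h2]
  push_cast
  field_simp
  ring

lemma count_dvd_sub_add (q W M : ℕ) (a : ℕ) :
    Nat.count (fun n : ℕ => (q : ℤ) ∣ n - W - a) (W + M) =
      Nat.count (fun n : ℕ => (q : ℤ) ∣ n - W - a) W + Nat.count (· ≡ a [MOD q]) M := by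
  rw [Nat.count_add]
  congr 2
  ext n
  rw [← Int.natCast_modEq_iff, Int.modEq_comm, Int.modEq_iff_dvd]
  push_cast
  rw [add_sub_cancel_left]

/-- If a counting function decomposes into residue classes relative to a common shift `W`, all
biased in the same direction by at least `ε`, it is large somewhere before `W + P`. -/
lemma exists_abs_sum_count_ge {ι : Type*} (T : Finset ι) (q a : ι → ℕ) (W P : ℕ) (ε : ℝ)
    (hP : 0 < P) (hq : ∀ k ∈ T, q k ∣ P) (ha : ∀ k ∈ T, a k < q k)
    (h : (∀ k ∈ T, ε ≤ 1 / 2 - (a k : ℝ) / q k - 1 / (2 * q k)) ∨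
      (∀ k ∈ T, 1 / 2 - (a k : ℝ) / q k - 1 / (2 * q k) ≤ -ε)) :
    ∃ M < W + P, (T.card : ℝ) * ε / 2 ≤
      |∑ k ∈ T, ((Nat.count (fun n : ℕ => (q k : ℤ) ∣ n - W - a k) M : ℝ) - (M : ℝ) / q k)| := by
  set D : ℕ → ℝ := fun M =>
    ∑ k ∈ T, ((Nat.count (fun n : ℕ => (q k : ℤ) ∣ n - W - a k) M : ℝ) - (M : ℝ) / q k) with hD
  by_contra! hcon
  have hdiff : ∀ M, D (W + M) - D W =
      ∑ k ∈ T, ((Nat.count (· ≡ a k [MOD q k]) M : ℝ) - (M : ℝ) / q k) := by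
    intro M
    rw [hD, ← Finset.sum_sub_distrib]
    refine Finset.sum_congr rfl fun k _ => ?_
    rw [count_dvd_sub_add]
    push_cast
    ring
  have hsum : ∑ M ∈ Finset.range P, (D (W + M) - D W) =
      P * ∑ k ∈ T, (1 / 2 - (a k : ℝ) / q k - 1 / (2 * q k)) := by
    simp_rw [hdiff]
    rw [Finset.sum_comm, Finset.mul_sum]
    exact Finset.sum_congr rfl fun k hk =>
      sum_range_count_modEq_sub_div (Nat.zero_lt_of_lt (ha k hk)) (ha k hk) (hq k hk)
  have hP' : (0 : ℝ) < P := by exact_mod_cast hP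
  have hne : (Finset.range P).Nonempty := Finset.nonempty_range_iff.mpr hP.ne'
  have hW := abs_lt.mp (hcon W (by omega))
  have hM : ∀ M ∈ Finset.range P, _ := fun M hM =>
    abs_lt.mp (hcon (W + M) (by simpa using hM))
  have hup : ∑ M ∈ Finset.range P, (D (W + M) - D W) < P * (T.card * ε) := by
    refine (Finset.sum_lt_sum_of_nonempty hne (g := fun _ => T.card * ε) fun M h' => ?_).trans_eq
      (by simp)
    have := hM M h'
    linarith [this.2, hW.1]
  have hlo : -(P * (T.card * ε)) < ∑ M ∈ Finset.range P, (D (W + M) - D W) := by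
    refine Eq.trans_lt (by simp) (Finset.sum_lt_sum_of_nonempty hne
      (f := fun _ => -(T.card * ε)) fun M h' => ?_)
    have := hM M h'
    linarith [this.1, hW.2]
  rw [hsum] at hup hlo
  rcases h with h | h
  · have := Finset.card_nsmul_le_sum T _ ε h
    rw [nsmul_eq_mul] at this
    linarith [mul_le_mul_of_nonneg_left this hP'.le]
  · have := Finset.sum_le_card_nsmul T _ (-ε) h
    rw [nsmul_eq_mul] at this
    linarith [mul_le_mul_of_nonneg_left this hP'.le]

end Counting

section ChineseRemainder

variable {s : ℕ} {u c ρ : Fin s → ℕ} {b : ℕ}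

lemma exists_modEq_mul_prod_erase (hu : ∀ i, 0 < u i)
    (hcop : ∀ i j, i ≠ j → Nat.Coprime (u i) (u j)) (c : Fin s → ℕ) :
    ∃ b < ∏ i, u i, ∀ i, b ≡ c i * ∏ j ∈ Finset.univ.erase i, u j [MOD u i] := by
  have h1 : ∀ i ∈ Finset.univ, u i ≠ 0 := fun i _ => (hu i).ne'
  have h2 : Set.Pairwise (Finset.univ : Finset (Fin s)) (Function.onFun Nat.Coprime u) :=
    fun i _ j _ hij => hcop i j hij
  exact ⟨Nat.chineseRemainderOfFinset _ u Finset.univ h1 h2,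
    Nat.chineseRemainderOfFinset_lt_prod _ u h1 h2,
    fun i => (Nat.chineseRemainderOfFinset _ u Finset.univ h1 h2).2 i (Finset.mem_univ i)⟩

lemma two_mul_ne_prod (hs : 2 ≤ s) (hcop : ∀ i j, i ≠ j → Nat.Coprime (u i) (u j))
    (hc : ∀ i, ¬ u i ∣ c i)
    (hb : ∀ i, b ≡ c i * ∏ j ∈ Finset.univ.erase i, u j [MOD u i]) :
    2 * b ≠ ∏ i, u i := by
  intro h
  obtain ⟨i, hi⟩ : ∃ i, Nat.Coprime (u i) 2 := by
    by_contra! hcon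
    have heven : ∀ i, 2 ∣ u i := fun i => by
      by_contra hi
      exact hcon i ((Nat.Prime.coprime_iff_not_dvd Nat.prime_two).mpr hi).symm
    have := Nat.dvd_gcd (heven ⟨0, by omega⟩) (heven ⟨1, by omega⟩)
    rw [Nat.Coprime.gcd_eq_one (hcop _ _ (by simp))] at this
    omega
  have h1 : u i ∣ b := hi.dvd_of_dvd_mul_left (h ▸ Finset.dvd_prod_of_mem u (Finset.mem_univ i))
  have h2 : u i ∣ c i * ∏ j ∈ Finset.univ.erase i, u j := ((hb i).dvd_iff dvd_rfl).mp h1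
  have h3 : Nat.Coprime (u i) (∏ j ∈ Finset.univ.erase i, u j) :=
    Nat.Coprime.prod_right fun j hj => hcop i j (Finset.ne_of_mem_erase hj).symm
  exact hc i (h3.dvd_of_dvd_mul_right h2)

/-- If `u j ^ ρ j ≡ 1` modulo the other bases, the residue classes `c i * u i ^ (ρ i - 1)` modulo
`u i ^ ρ i` combine to a class whose relative position in the period does not depend on `ρ`. -/
lemma forall_pow_dvd_iff (hcop : ∀ i j, i ≠ j → Nat.Coprime (u i) (u j))
    (hρ : ∀ i, 1 ≤ ρ i) (hone : ∀ i j, i ≠ j → u j ^ ρ j ≡ 1 [MOD u i])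
    (hb : ∀ i, b ≡ c i * ∏ j ∈ Finset.univ.erase i, u j [MOD u i]) (x : ℤ) :
    (∀ i, (u i : ℤ) ^ ρ i ∣ x - c i * u i ^ (ρ i - 1)) ↔
      ((∏ i, u i ^ ρ i : ℕ) : ℤ) ∣ x - (b * ∏ i, u i ^ (ρ i - 1) : ℕ) := by
  have key : ∀ i, (u i : ℤ) ^ ρ i ∣
      (b * ∏ i, u i ^ (ρ i - 1) : ℕ) - (c i * u i ^ (ρ i - 1) : ℤ) := by
    intro i
    have h1 : b * ∏ j ∈ Finset.univ.erase i, u j ^ (ρ j - 1) ≡ c i [MOD u i] := by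
      refine ((hb i).mul_right _).trans ?_
      rw [mul_assoc, ← Finset.prod_mul_distrib]
      have h2 : ∏ j ∈ Finset.univ.erase i, u j * u j ^ (ρ j - 1) ≡ 1 [MOD u i] := by
        refine (Nat.ModEq.prod (g := fun _ => 1) fun j hj => ?_).trans (by simp [Nat.ModEq.refl])
        rw [← pow_succ', Nat.sub_add_cancel (hρ j)]
        exact hone i j (Finset.ne_of_mem_erase hj).symm
      simpa using h2.mul_left (c i)
    obtain ⟨e, he⟩ := Int.modEq_iff_dvd.mp (Int.natCast_modEq_iff.mpr h1.symm)
    refine ⟨e, ?_⟩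
    rw [← Finset.mul_prod_erase _ _ (Finset.mem_univ i)]
    have h3 : (u i : ℤ) ^ ρ i = u i ^ (ρ i - 1) * u i := by
      rw [← pow_succ, Nat.sub_add_cancel (hρ i)]
    rw [h3]
    push_cast at he ⊢
    linear_combination (u i : ℤ) ^ (ρ i - 1) * he
  have h4 : ∀ i, (u i : ℤ) ^ ρ i ∣ x - c i * u i ^ (ρ i - 1) ↔
      (u i : ℤ) ^ ρ i ∣ x - (b * ∏ i, u i ^ (ρ i - 1) : ℕ) := by
    intro i
    refine dvd_iff_dvd_of_dvd_sub ?_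
    rw [sub_sub_sub_cancel_left]
    exact key i
  rw [forall_congr' h4]
  push_cast
  constructor
  · intro h
    refine Finset.prod_dvd_of_coprime (fun i _ j _ hij => ?_) fun i _ => h i
    exact (Nat.isCoprime_iff_coprime.mpr (hcop i j hij)).pow
  · intro h i
    exact (Finset.dvd_prod_of_mem (fun i => (u i : ℤ) ^ ρ i) (Finset.mem_univ i)).trans h

lemma bias_of_ne {U b Q : ℕ} (hU : 0 < U) (hQ : 2 ≤ Q) (hb : 2 * b ≠ U) :
    if 2 * b < U then 1 / (4 * (U : ℝ)) ≤
        1 / 2 - ((b * Q : ℕ) : ℝ) / (U * Q : ℕ) - 1 / (2 * (U * Q : ℕ))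
      else 1 / 2 - ((b * Q : ℕ) : ℝ) / (U * Q : ℕ) - 1 / (2 * (U * Q : ℕ)) ≤
        -(1 / (4 * (U : ℝ))) := by
  have hU' : (0 : ℝ) < U := by exact_mod_cast hU
  have hQ' : (2 : ℝ) ≤ Q := by exact_mod_cast hQ
  have hid : 1 / 2 - ((b * Q : ℕ) : ℝ) / (U * Q : ℕ) - 1 / (2 * (U * Q : ℕ)) =
      ((U - 2 * b) * 2 - 2 / Q) / (4 * U) := by
    push_cast
    field_simp
    ring
  have h0 : 0 ≤ 2 / (Q : ℝ) := by positivity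
  have h1 : 2 / (Q : ℝ) ≤ 1 := by
    rw [div_le_one (by positivity)]
    exact hQ'
  rw [hid, ← neg_div]
  split_ifs with h
  · have h2 : (2 * b : ℝ) + 1 ≤ U := by exact_mod_cast h
    gcongr
    linarith
  · have h2 : (U : ℝ) + 1 ≤ 2 * b := by exact_mod_cast (show U + 1 ≤ 2 * b by omega)
    gcongr
    linarith

end ChineseRemainder

/-- Among the digit positions that are multiples of `τ`, a proportion of at least `1 / u` share the
residue `c` encoding the change of the digit from `σ⁻¹ 1` to `σ⁻¹ 0`. -/
lemma exists_positions {u v : ℕ} (hu : 2 ≤ u) (huv : Nat.Coprime u v) {σ : ℕ → ℕ → ℕ}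
    (hσ : ∀ r, Set.BijOn (σ r) (Set.Iio u) (Set.Iio u)) {τ m : ℕ} (hτ : 0 < τ) (hm : 0 < m) :
    ∃ (R : Finset ℕ) (c : ℕ), (∀ ρ ∈ R, τ ∣ ρ ∧ τ ≤ ρ ∧ ρ ≤ m * τ) ∧ R.Nonempty ∧
      (m : ℝ) / u ≤ R.card ∧ ¬ u ∣ c ∧
      ∀ ρ ∈ R, ∀ a < u, ∀ b < u, σ (ρ - 1) a = 0 → σ (ρ - 1) b = 1 →
        (v : ℤ) ^ ρ * c ≡ a - b [ZMOD u] := by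
  have hex : ∀ ρ : ℕ, ∃ δ < u, ¬ u ∣ δ ∧ ∀ a < u, ∀ b < u, σ (ρ - 1) a = 0 → σ (ρ - 1) b = 1 →
      (v : ℤ) ^ ρ * δ ≡ a - b [ZMOD u] := by
    intro ρ
    obtain ⟨a, ha, ha0⟩ := (hσ (ρ - 1)).surjOn (show 0 ∈ Set.Iio u from by simp; omega)
    obtain ⟨b, hb, hb1⟩ := (hσ (ρ - 1)).surjOn (show 1 ∈ Set.Iio u from by simp; omega)
    obtain ⟨w, hw⟩ := exists_pow_mul_modEq huv ρ (a - b)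
    have hu0 : (u : ℤ) ≠ 0 := by omega
    have hcast : ((w % u).toNat : ℤ) = w % u := Int.toNat_of_nonneg (Int.emod_nonneg w hu0)
    have hlt : w % u < u := Int.emod_lt_of_pos w (by omega)
    have hcong : (v : ℤ) ^ ρ * (w % u).toNat ≡ a - b [ZMOD u] := by
      rw [hcast]
      exact ((Int.mod_modEq w u).mul_left _).trans hw
    refine ⟨(w % u).toNat, by omega, fun hdvd => ?_, ?_⟩
    · have h1 : (u : ℤ) ∣ (a : ℤ) - b :=
        hcong.dvd_iff.mp (dvd_mul_of_dvd_right (Int.natCast_dvd_natCast.mpr hdvd) _)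
      have h2 : b = a := Nat.ModEq.eq_of_lt_of_lt
        (Int.natCast_modEq_iff.mp (Int.modEq_iff_dvd.mpr h1)) hb ha
      rw [h2, ha0] at hb1
      exact zero_ne_one hb1
    · intro a' ha' b' hb' ha0' hb1'
      rw [(hσ (ρ - 1)).injOn ha' ha (ha0'.trans ha0.symm),
        (hσ (ρ - 1)).injOn hb' hb (hb1'.trans hb1.symm)]
      exact hcong
  choose δ hδu hδ hδσ using hex
  set S : Finset ℕ := (Finset.Icc 1 m).image (· * τ) with hS
  have hcard : S.card = m := by
    rw [hS, Finset.card_image_of_injective _ (mul_left_injective₀ hτ.ne'), Nat.card_Icc,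
      Nat.add_sub_cancel]
  have hu' : (u : ℝ) ≠ 0 := by positivity
  obtain ⟨c, -, hc⟩ := Finset.exists_le_card_fiber_of_nsmul_le_card_of_maps_to (s := S)
    (t := Finset.range u) (f := δ) (b := (m : ℝ) / u)
    (fun ρ _ => Finset.mem_range.mpr (hδu ρ)) (Finset.nonempty_range_iff.mpr (by omega))
    (by rw [hcard, Finset.card_range, nsmul_eq_mul, mul_div_cancel₀ _ hu'])
  have hne : {ρ ∈ S | δ ρ = c}.Nonempty := by
    rw [← Finset.card_pos]
    have : (0 : ℝ) < m / u := by positivity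
    exact_mod_cast this.trans_le hc
  refine ⟨{ρ ∈ S | δ ρ = c}, c, ?_, hne, hc, ?_, ?_⟩
  · intro ρ hρ
    obtain ⟨k, hk, rfl⟩ := Finset.mem_image.mp (Finset.mem_filter.mp hρ).1
    rw [Finset.mem_Icc] at hk
    exact ⟨dvd_mul_left τ k, Nat.le_mul_of_pos_left τ hk.1, Nat.mul_le_mul_right τ hk.2⟩
  · obtain ⟨ρ, hρ⟩ := hne
    rw [← (Finset.mem_filter.mp hρ).2]
    exact hδ ρ
  · intro ρ hρ
    rw [← (Finset.mem_filter.mp hρ).2]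
    exact hδσ ρ

section Numerics

lemma exists_number_of_positions {u₀ s U τ N : ℕ} (hu₀ : 2 ≤ u₀) (hs : 1 ≤ s) (hU : 1 ≤ U)
    (hUs : U ≤ u₀ ^ s) (hτ : τ ≤ U) (hN : u₀ ^ (4 * s * u₀ ^ (s + 1) * U) < N) :
    ∃ m : ℕ, 0 < m ∧ 2 * U ^ (m * τ) ≤ N ∧
      Real.log N / Real.log u₀ ≤ 2 * (s * (u₀ : ℝ) ^ s) * m := by
  set A := s * u₀ ^ s with hA
  set K := Nat.log u₀ N with hK
  have hN0 : N ≠ 0 := by omega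
  have hApos : 0 < A := by positivity
  have hKA : 4 * A ≤ K := by
    refine le_trans ?_ (Nat.le_log_of_pow_le (by omega) hN.le)
    calc 4 * A = 4 * s * u₀ ^ s * 1 := by rw [hA]; ring
      _ ≤ 4 * s * u₀ ^ (s + 1) * U := by
        gcongr <;> omega
  have hdm := Nat.div_add_mod (K - 1) A
  have hmod := Nat.mod_lt (K - 1) hApos
  have hmA : K + 1 ≤ 2 * (A * ((K - 1) / A)) := by omega
  refine ⟨(K - 1) / A, Nat.div_pos (by omega) hApos, ?_, ?_⟩
  · calc 2 * U ^ ((K - 1) / A * τ) ≤ u₀ * (u₀ ^ s) ^ ((K - 1) / A * u₀ ^ s) := by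
          gcongr
          · exact hU.trans hUs
          · exact hτ.trans hUs
      _ = u₀ ^ (A * ((K - 1) / A) + 1) := by
          rw [← pow_mul, ← pow_succ', hA]
          ring_nf
      _ ≤ u₀ ^ K := Nat.pow_le_pow_right (by omega) (by omega)
      _ ≤ N := Nat.pow_log_le_self u₀ hN0
  · have hlog : 0 < Real.log u₀ := Real.log_pos (by exact_mod_cast hu₀)
    rw [div_le_iff₀ hlog]
    have h1 : (N : ℝ) ≤ (u₀ : ℝ) ^ (K + 1) := by
      exact_mod_cast (Nat.lt_pow_succ_log_self (by omega) N).le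
    have h2 : Real.log N ≤ (K + 1 : ℕ) * Real.log u₀ := by
      rw [← Real.log_pow]
      exact Real.log_le_log (by positivity) h1
    refine h2.trans (mul_le_mul_of_nonneg_right ?_ hlog.le)
    have h3 : ((K + 1 : ℕ) : ℝ) ≤ (2 * (A * ((K - 1) / A)) : ℕ) := by exact_mod_cast hmA
    refine h3.trans_eq ?_
    rw [hA]
    push_cast
    ring

/-- The final constant, written through the number of positions per coordinate. -/
lemma constant_mul_log_pow_le {s m : ℕ} {u₀ U n x : ℝ} (hs : 1 ≤ s) (hu₀ : 1 < u₀) (hU : 0 < U)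
    (hn : 0 ≤ n) (hm : n / Real.log u₀ ≤ 2 * (s * u₀ ^ s) * m) (hx : ((m : ℝ) / u₀) ^ s ≤ x) :
    (1 / (2 ^ (s + 2) * (s : ℝ) ^ s * U * u₀ ^ (s ^ 2 + s) * Real.log u₀ ^ s)) / 2 * n ^ s ≤
      x * (1 / (4 * U)) / 2 := by
  have hlog : 0 < Real.log u₀ := Real.log_pos hu₀
  have hs' : (0 : ℝ) < s := by exact_mod_cast hs
  have hu₀' : 0 < u₀ := by linarith
  have h1 : n / (2 * s * u₀ ^ (s + 1) * Real.log u₀) ≤ m / u₀ := by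
    rw [div_le_div_iff₀ (by positivity) hu₀']
    rw [div_le_iff₀ hlog] at hm
    calc n * u₀ ≤ 2 * (s * u₀ ^ s) * m * Real.log u₀ * u₀ := by gcongr
      _ = _ := by ring
  have h2 := (pow_le_pow_left₀ (by positivity) h1 s).trans hx
  calc _ = (n / (2 * s * u₀ ^ (s + 1) * Real.log u₀)) ^ s * (1 / (4 * U)) / 2 := by
        rw [div_pow, mul_pow, mul_pow, mul_pow, ← pow_mul,
          show (s + 1) * s = s ^ 2 + s by ring, pow_add 2 s 2]
        field_simp
        ring
    _ ≤ _ := by gcongr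

end Numerics

section Discrepancy

lemma abs_count_sub_le_mul_starDisc {s M : ℕ} (hM : 1 ≤ M) (x : ℕ → Fin s → ℝ) {y : Fin s → ℝ}
    (hy : ∀ i, y i ∈ Set.Ioc (0 : ℝ) 1) :
    |(Nat.card {n : ℕ | n < M ∧ ∀ i, x n i < y i} : ℝ) - M * ∏ i, y i| ≤ M * starDisc s M x := by
  have hM' : (0 : ℝ) < M := by exact_mod_cast hM
  have hle : |(Nat.card {n : ℕ | n < M ∧ ∀ i, x n i < y i} : ℝ) / M - ∏ i, y i| ≤
      starDisc s M x := by
    refine le_csSup ⟨1, ?_⟩ ⟨y, hy, rfl⟩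
    rintro _ ⟨z, hz, rfl⟩
    have h1 : (Nat.card {n : ℕ | n < M ∧ ∀ i, x n i < z i} : ℝ) / M ≤ 1 := by
      rw [div_le_one hM', Nat.cast_le, Nat.card_coe_set_eq]
      refine (Set.ncard_le_ncard (fun n hn => hn.1) (Set.finite_Iio M)).trans_eq ?_
      simp [Set.ncard_eq_toFinset_card']
    have h2 : 0 ≤ (Nat.card {n : ℕ | n < M ∧ ∀ i, x n i < z i} : ℝ) / M := by positivity
    have h3 : ∏ i, z i ≤ 1 := Finset.prod_le_one (fun i _ => (hz i).1.le) fun i _ => (hz i).2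
    have h4 : 0 ≤ ∏ i, z i := Finset.prod_nonneg fun i _ => (hz i).1.le
    rw [abs_le]
    constructor <;> linarith
  calc _ = M * |(Nat.card {n : ℕ | n < M ∧ ∀ i, x n i < y i} : ℝ) / M - ∏ i, y i| := by
        rw [← abs_of_pos hM', ← abs_mul, abs_of_pos hM', mul_sub, mul_div_cancel₀ _ hM'.ne']
    _ ≤ _ := by gcongr

lemma le_sSup_mul_starDisc {s N M : ℕ} (hM : 1 ≤ M) (hMN : M ≤ N) (x : ℕ → Fin s → ℝ) :
    M * starDisc s M x ≤
      sSup {d : ℝ | ∃ M : ℕ, 1 ≤ M ∧ M ≤ N ∧ d = (M : ℝ) * starDisc s M x} := by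
  refine le_csSup (Set.Finite.bddAbove ?_) ⟨M, hM, hMN, rfl⟩
  refine ((Set.finite_Icc 1 N).image fun M : ℕ => (M : ℝ) * starDisc s M x).subset ?_
  rintro _ ⟨M, h1, h2, rfl⟩
  exact ⟨M, ⟨h1, h2⟩, rfl⟩

lemma card_lt_and_eq_sum_count {ι : Type*} (T : Finset ι) (p : ℕ → Prop) (q : ι → ℕ → Prop)
    [∀ k, DecidablePred (q k)] (hpq : ∀ n, p n ↔ ∃ k ∈ T, q k n)
    (huniq : ∀ n, ∀ k ∈ T, ∀ l ∈ T, q k n → q l n → k = l) (M : ℕ) :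
    Nat.card {n : ℕ | n < M ∧ p n} = ∑ k ∈ T, Nat.count (q k) M := by
  classical
  simp_rw [Nat.count_eq_card_filter_range]
  rw [← Finset.card_biUnion, Nat.card_coe_set_eq, ← Set.ncard_coe_finset]
  · congr 1
    ext n
    simp [hpq]
  · intro k hk l hl hkl
    refine Finset.disjoint_left.mpr fun n h1 h2 => hkl ?_
    exact huniq n k hk l hl (Finset.mem_filter.mp h1).2 (Finset.mem_filter.mp h2).2

end Discrepancy

section Box

variable {u v : ℕ} {σ : ℕ → ℕ → ℕ} {R : Finset ℕ}

lemma sum_indicator_div_pow {t : ℕ} (hR : ∀ ρ ∈ R, 1 ≤ ρ ∧ ρ ≤ t) :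
    ∑ r ∈ Finset.range t, ((if r + 1 ∈ R then 1 else 0 : ℕ) : ℝ) / (u : ℝ) ^ (r + 1) =
      ∑ ρ ∈ R, 1 / (u : ℝ) ^ ρ := by
  have h : ∀ r, ((if r + 1 ∈ R then 1 else 0 : ℕ) : ℝ) / (u : ℝ) ^ (r + 1) =
      if r + 1 ∈ R then 1 / (u : ℝ) ^ (r + 1) else 0 := fun r => by
    split_ifs <;> simp
  rw [Finset.sum_congr rfl fun r _ => h r, ← Finset.sum_filter]
  refine Finset.sum_bij (fun r _ => r + 1) (fun r hr => (Finset.mem_filter.mp hr).2)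
    (fun r _ r' _ h => by simpa using h) (fun ρ hρ => ?_) fun _ _ => rfl
  obtain ⟨h1, h2⟩ := hR ρ hρ
  refine ⟨ρ - 1, Finset.mem_filter.mpr ⟨Finset.mem_range.mpr (by omega), ?_⟩, by omega⟩
  rwa [Nat.sub_add_cancel h1]

lemma sum_one_div_pow_mem_Ioc {t : ℕ} (hu : 2 ≤ u) (hR : ∀ ρ ∈ R, 1 ≤ ρ ∧ ρ ≤ t)
    (hne : R.Nonempty) : ∑ ρ ∈ R, 1 / (u : ℝ) ^ ρ ∈ Set.Ioc (0 : ℝ) 1 := by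
  refine ⟨Finset.sum_pos (fun ρ _ => by positivity) hne, ?_⟩
  rw [← sum_indicator_div_pow hR]
  exact sum_digits_le_one (by omega) (fun r => by split_ifs <;> omega) t

lemma ratPhiTrunc_lt_iff {t T W c : ℕ} (hu : 2 ≤ u) (huv : Nat.Coprime u v)
    (hσ : ∀ r, Set.BijOn (σ r) (Set.Iio u) (Set.Iio u)) (hR : ∀ ρ ∈ R, 1 ≤ ρ ∧ ρ ≤ T)
    (hTt : T ≤ t)
    (hW : ∀ r < T, σ r (ratDigit u v W r) = if r + 1 ∈ R then 1 else 0)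
    (hc : ∀ ρ ∈ R, ∀ a < u, ∀ b < u, σ (ρ - 1) a = 0 → σ (ρ - 1) b = 1 →
      (v : ℤ) ^ ρ * c ≡ a - b [ZMOD u]) (n : ℕ) :
    ratPhiTrunc u v σ t n < ∑ ρ ∈ R, 1 / (u : ℝ) ^ ρ ↔
      ∃ ρ ∈ R, (u : ℤ) ^ ρ ∣ (n : ℤ) - W - c * u ^ (ρ - 1) := by
  have hu0 : 0 < u := by omega
  rw [← sum_indicator_div_pow fun ρ hρ => ⟨(hR ρ hρ).1, (hR ρ hρ).2.trans hTt⟩, ratPhiTrunc,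
    sum_digits_lt_iff hu0 (fun r => (hσ r).mapsTo (ratDigit_lt hu0 n r))
      (fun r => by split_ifs <;> omega)]
  have hstep : ∀ r, r + 1 ∈ R →
      ((σ r (ratDigit u v n r) < (if r + 1 ∈ R then 1 else 0) ∧
        ∀ j < r, σ j (ratDigit u v n j) = if j + 1 ∈ R then 1 else 0) ↔
      (u : ℤ) ^ (r + 1) ∣ (n : ℤ) - W - c * u ^ r) := by
    intro r hr
    have hrT : r + 1 ≤ T := (hR _ hr).2
    obtain ⟨a, ha, ha0⟩ := (hσ r).surjOn (show 0 ∈ Set.Iio u from hu0)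
    have hWr := hW r (by omega)
    rw [if_pos hr] at hWr
    have hna : σ r (ratDigit u v n r) = 0 ↔ ratDigit u v n r = a := by
      rw [← (hσ r).injOn.eq_iff (ratDigit_lt hu0 _ _) ha, ha0]
    rw [← ratDigit_initial_segment_iff (a := a) hu0 huv ha rfl
      (hc _ hr a ha _ (ratDigit_lt hu0 _ _) ha0 hWr), if_pos hr, Nat.lt_one_iff, and_comm,
      hna]
    refine and_congr_left fun _ => forall₂_congr fun j hj => ?_
    rw [← hW j (by omega), (hσ j).injOn.eq_iff (ratDigit_lt hu0 _ _) (ratDigit_lt hu0 _ _)]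
  constructor
  · rintro ⟨r, -, h⟩
    have hr : r + 1 ∈ R := by
      by_contra hr
      simp [hr] at h
    exact ⟨r + 1, hr, (hstep r hr).mp h⟩
  · rintro ⟨ρ, hρ, h⟩
    obtain ⟨r, rfl⟩ : ∃ r, ρ = r + 1 := ⟨ρ - 1, by have := (hR ρ hρ).1; omega⟩
    exact ⟨r, by have := (hR _ hρ).2; omega, (hstep r hρ).mpr h⟩

lemma pow_dvd_sub_unique {u c ρ ρ' : ℕ} {x : ℤ} (hu : 0 < u) (hc : ¬ u ∣ c)
    (hρ : 1 ≤ ρ) (hρ' : 1 ≤ ρ')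
    (h : (u : ℤ) ^ ρ ∣ x - c * u ^ (ρ - 1)) (h' : (u : ℤ) ^ ρ' ∣ x - c * u ^ (ρ' - 1)) :
    ρ = ρ' := by
  wlog hlt : ρ < ρ' generalizing ρ ρ'
  · rcases Nat.lt_trichotomy ρ ρ' with h1 | h1 | h1
    · exact absurd h1 hlt
    · exact h1
    · exact (this hρ' hρ h' h h1).symm
  exfalso
  have h1 : (u : ℤ) ^ ρ ∣ u ^ (ρ' - 1) := pow_dvd_pow _ (by omega)
  have h2 : (u : ℤ) ^ ρ ∣ x := by
    have := (h1.trans (pow_dvd_pow _ (Nat.sub_le ρ' 1))).trans h'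
    exact (dvd_sub_left (h1.mul_left (c : ℤ))).mp this
  have h3 : (u : ℤ) ^ ρ ∣ c * u ^ (ρ - 1) := (dvd_sub_right h2).mp h
  have h4 : (u : ℤ) ^ ρ = u * u ^ (ρ - 1) := by rw [← pow_succ', Nat.sub_add_cancel hρ]
  rw [h4] at h3
  exact hc (Int.natCast_dvd_natCast.mp
    ((mul_dvd_mul_iff_right (pow_ne_zero _ (by exact_mod_cast hu.ne'))).mp h3))

end Box

lemma exists_lt_forall_ratDigit_eq {s : ℕ} {u v : Fin s → ℕ} (hu : ∀ i, 2 ≤ u i)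
    (huv : ∀ i, Nat.Coprime (u i) (v i)) (hcop : ∀ i j, i ≠ j → Nat.Coprime (u i) (u j))
    {d : Fin s → ℕ → ℕ} (hd : ∀ i r, d i r < u i) (T : ℕ) :
    ∃ W < (∏ i, u i) ^ T, ∀ i, ∀ r < T, ratDigit (u i) (v i) (W : ℕ) r = d i r := by
  have hu0 : ∀ i, 0 < u i := fun i => by have := hu i; omega
  choose z hz using fun i => exists_forall_ratDigit_eq (hu0 i) (huv i) (hd i) T
  have h1 : ∀ i ∈ Finset.univ, u i ^ T ≠ 0 := fun i _ => (pow_pos (hu0 i) T).ne'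
  have h2 : Set.Pairwise (Finset.univ : Finset (Fin s))
      (Function.onFun Nat.Coprime fun i => u i ^ T) :=
    fun i _ j _ hij => (hcop i j hij).pow T T
  refine ⟨Nat.chineseRemainderOfFinset (fun i => (z i % (u i : ℤ) ^ T).toNat) _ Finset.univ h1 h2,
    ?_, fun i => ?_⟩
  · rw [← Finset.prod_pow]
    exact Nat.chineseRemainderOfFinset_lt_prod _ _ h1 h2
  · have h3 := (Nat.chineseRemainderOfFinset (fun i => (z i % (u i : ℤ) ^ T).toNat) _
      Finset.univ h1 h2).2 i (Finset.mem_univ i)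
    generalize (Nat.chineseRemainderOfFinset (fun i => (z i % (u i : ℤ) ^ T).toNat) _
      Finset.univ h1 h2).1 = W at h3 ⊢
    have hpos : (0 : ℤ) < (u i : ℤ) ^ T := pow_pos (by exact_mod_cast hu0 i) T
    have h4 : (W : ℤ) ≡ z i [ZMOD (u i : ℤ) ^ T] := by
      have h5 := Int.natCast_modEq_iff.mpr h3
      rw [Int.toNat_of_nonneg (Int.emod_nonneg _ hpos.ne'), Nat.cast_pow] at h5
      exact h5.trans (Int.mod_modEq _ _)
    intro r hr
    rw [(forall_ratDigit_eq_iff (hu0 i) (huv i) W (z i) T).mpr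
      (Int.modEq_iff_dvd.mp h4.symm) r hr, hz i r hr]

/-- For `s ≥ 2`, `u_0 = max_i u_i`, `C = 1/(2^{s+2} s^s u_1⋯u_s u_0^{s²+s} (log u_0)^s)`,
every `N > u_0^{4s·u_0^{s+1}·u_1⋯u_s}`, and `t = max_i ⌈log_{u_i} N⌉`:
`sup_{1≤M≤N} M·D*_M(([x_n]_t)_n) ≥ (C/2)·(log N)^s` for the truncated generalized Halton
sequence in rational bases. -/
theorem truncated_halton_sup_weighted_star_discrepancy_lower_bound
    (s : ℕ) (hs : 2 ≤ s) (u v : Fin s → ℕ)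
    (hu : ∀ i, 2 ≤ u i) (hv : ∀ i, 1 ≤ v i)
    (huv : ∀ i, Nat.Coprime (u i) (v i))
    (hcop : ∀ i j, i ≠ j → Nat.Coprime (u i) (u j))
    (σ : Fin s → ℕ → ℕ → ℕ)
    (hσ : ∀ i r, Set.BijOn (σ i r) (Set.Iio (u i)) (Set.Iio (u i)))
    (N : ℕ)
    (hN : (Finset.univ.sup u) ^ (4 * s * (Finset.univ.sup u) ^ (s + 1) * ∏ i, u i) < N)
    (t : ℕ) (ht : t = Finset.univ.sup fun i => Nat.clog (u i) N) :
    (1 / (2 ^ (s + 2) * (s : ℝ) ^ s * (∏ i, (u i : ℝ)) *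
        ((Finset.univ.sup u : ℕ) : ℝ) ^ (s ^ 2 + s) *
        (Real.log ((Finset.univ.sup u : ℕ) : ℝ)) ^ s)) / 2 * (Real.log N) ^ s ≤
      sSup { d : ℝ | ∃ M : ℕ, 1 ≤ M ∧ M ≤ N ∧
        d = (M : ℝ) * starDisc s M (fun n i => ratPhiTrunc (u i) (v i) (σ i) t n) } := by
  classical
  set u₀ := Finset.univ.sup u with hu₀
  set U := ∏ i, u i with hU
  have hu0 : ∀ i, 0 < u i := fun i => by have := hu i; omega
  have huu₀ : ∀ i, u i ≤ u₀ := fun i => Finset.le_sup (Finset.mem_univ i)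
  have hu₀2 : 2 ≤ u₀ := (hu ⟨0, by omega⟩).trans (huu₀ _)
  have hU0 : 0 < U := Finset.prod_pos fun i _ => hu0 i
  have hUs : U ≤ u₀ ^ s := by
    simpa using Finset.prod_le_pow_card Finset.univ u u₀ fun i _ => huu₀ i
  have hU2 : 2 < U := by
    calc 2 < 2 ^ 2 := by norm_num
      _ ≤ 2 ^ s := Nat.pow_le_pow_right (by norm_num) hs
      _ ≤ U := by simpa using Finset.pow_card_le_prod Finset.univ u 2 fun i _ => hu i
  set τ := Nat.totient U with hτ
  have hτ0 : 0 < τ := Nat.totient_pos.mpr hU0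
  have hτ2 : 2 ≤ τ := by
    obtain ⟨k, hk⟩ := Nat.totient_even hU2
    omega
  have hone : ∀ i j, i ≠ j → ∀ r, τ ∣ r → u j ^ r ≡ 1 [MOD u i] := by
    intro i j hij r hr
    obtain ⟨k, rfl⟩ :=
      (Nat.totient_dvd_of_dvd (Finset.dvd_prod_of_mem u (Finset.mem_univ i))).trans hr
    rw [pow_mul]
    simpa using (Nat.ModEq.pow_totient (hcop j i hij.symm)).pow k
  obtain ⟨m, hm0, hmN, hmlog⟩ := exists_number_of_positions hu₀2 (by omega) hU0 hUs
    (Nat.totient_le U) hN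
  choose R c hR hRne hRcard hc hRc using fun i => exists_positions (hu i) (huv i) (hσ i) hτ0 hm0
  set T := m * τ with hT
  have hRT : ∀ i, ∀ ρ ∈ R i, 1 ≤ ρ ∧ ρ ≤ T := fun i ρ hρ =>
    ⟨by have := (hR i ρ hρ).2.1; omega, (hR i ρ hρ).2.2⟩
  have hTt : T ≤ t := by
    let i : Fin s := ⟨0, by omega⟩
    rw [ht]
    refine le_trans ?_ (Finset.le_sup (f := fun i => Nat.clog (u i) N) (Finset.mem_univ i))
    refine (Nat.le_log_of_pow_le (hu i) ?_).trans (Nat.log_le_clog (u i) N)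
    have : u i ^ T ≤ U ^ T := Nat.pow_le_pow_left
      (Nat.le_of_dvd hU0 (Finset.dvd_prod_of_mem u (Finset.mem_univ i))) T
    omega
  choose d hd hdσ using fun i r => (hσ i r).surjOn
    (show (if r + 1 ∈ R i then 1 else 0) ∈ Set.Iio (u i) by
      have := hu i
      rw [Set.mem_Iio]
      split_ifs <;> omega)
  obtain ⟨W, hWP, hW⟩ := exists_lt_forall_ratDigit_eq hu huv hcop hd T
  rw [← hU] at hWP
  obtain ⟨b, hbU, hb⟩ := exists_modEq_mul_prod_erase hu0 hcop c
  have hb2 : 2 * b ≠ U := two_mul_ne_prod hs hcop hc hb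
  set K := Fintype.piFinset R with hK
  have hmem : ∀ k ∈ K, ∀ i, k i ∈ R i := fun k hk => Fintype.mem_piFinset.mp hk
  let q : (Fin s → ℕ) → ℕ := fun k => ∏ i, u i ^ k i
  let Q : (Fin s → ℕ) → ℕ := fun k => ∏ i, u i ^ (k i - 1)
  have hqQ : ∀ k ∈ K, q k = U * Q k := fun k hk => by
    simp only [q, Q, hU]
    rw [← Finset.prod_mul_distrib]
    refine Finset.prod_congr rfl fun i _ => ?_
    rw [← pow_succ', Nat.sub_add_cancel (hRT i _ (hmem k hk i)).1]
  have hQ2 : ∀ k ∈ K, 2 ≤ Q k := fun k hk => by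
    let i : Fin s := ⟨0, by omega⟩
    have h1 := (hR i _ (hmem k hk i)).2.1
    calc 2 ≤ u i := hu i
      _ ≤ u i ^ (k i - 1) := Nat.le_self_pow (by omega) _
      _ ≤ Q k := Nat.le_of_dvd (Finset.prod_pos fun j _ => pow_pos (hu0 j) _)
        (Finset.dvd_prod_of_mem (fun j => u j ^ (k j - 1)) (Finset.mem_univ i))
  obtain ⟨M, hMlt, hM⟩ := exists_abs_sum_count_ge K q (fun k => b * Q k) W (U ^ T)
    (1 / (4 * (U : ℝ))) (pow_pos hU0 T)
    (fun k hk => by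
      rw [hU, ← Finset.prod_pow]
      exact Finset.prod_dvd_prod_of_dvd _ _ fun i _ => pow_dvd_pow _ (hRT i _ (hmem k hk i)).2)
    (fun k hk => by
      rw [hqQ k hk]
      exact Nat.mul_lt_mul_of_pos_right hbU (by have := hQ2 k hk; omega))
    (by
      have h := fun k hk => bias_of_ne hU0 (hQ2 k hk) hb2
      by_cases hlt : 2 * b < U
      · refine Or.inl fun k hk => ?_
        rw [hqQ k hk]
        simpa only [if_pos hlt] using h k hk
      · refine Or.inr fun k hk => ?_
        rw [hqQ k hk]
        simpa only [if_neg hlt] using h k hk)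
  let y : Fin s → ℝ := fun i => ∑ ρ ∈ R i, 1 / (u i : ℝ) ^ ρ
  have hy : ∀ i, y i ∈ Set.Ioc (0 : ℝ) 1 := fun i =>
    sum_one_div_pow_mem_Ioc (hu i) (hRT i) (hRne i)
  have hdvd : ∀ n : ℕ, ∀ k ∈ K,
      ((∀ i, (u i : ℤ) ^ k i ∣ (n : ℤ) - W - c i * u i ^ (k i - 1)) ↔
        (q k : ℤ) ∣ n - W - (b * Q k : ℕ)) := fun n k hk =>
    forall_pow_dvd_iff hcop (fun i => (hRT i _ (hmem k hk i)).1)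
      (fun i j hij => hone i j hij _ (hR j _ (hmem k hk j)).1) hb _
  have hcount := card_lt_and_eq_sum_count K
    (fun n => ∀ i, ratPhiTrunc (u i) (v i) (σ i) t n < y i)
    (fun k n => (q k : ℤ) ∣ n - W - (b * Q k : ℕ))
    (fun n => by
      have h := fun i => ratPhiTrunc_lt_iff (hu i) (huv i) (hσ i) (hRT i) hTt
        (fun r hr => by rw [hW i r hr, hdσ i r]) (hRc i) n
      constructor
      · intro hn
        choose k hk hkn using fun i => (h i).mp (hn i)
        have hkK : k ∈ K := Fintype.mem_piFinset.mpr hk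
        exact ⟨k, hkK, (hdvd n k hkK).mp hkn⟩
      · rintro ⟨k, hk, hkn⟩ i
        exact (h i).mpr ⟨k i, hmem k hk i, (hdvd n k hk).mpr hkn i⟩)
    (fun n k hk l hl hkn hln => funext fun i =>
      pow_dvd_sub_unique (hu0 i) (hc i) (hRT i _ (hmem k hk i)).1 (hRT i _ (hmem l hl i)).1
        ((hdvd n k hk).mpr hkn i) ((hdvd n l hl).mpr hln i)) M
  have hvol : ∏ i, y i = ∑ k ∈ K, 1 / (q k : ℝ) := by
    simp only [y, q]
    rw [Finset.prod_univ_sum]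
    refine Finset.sum_congr rfl fun k _ => ?_
    push_cast
    simp
  have hsum : ∑ k ∈ K, ((Nat.count (fun n : ℕ => (q k : ℤ) ∣ n - W - (b * Q k : ℕ)) M : ℝ) -
      (M : ℝ) / q k) =
      (Nat.card {n : ℕ | n < M ∧ ∀ i, ratPhiTrunc (u i) (v i) (σ i) t n < y i} : ℝ) -
        M * ∏ i, y i := by
    rw [hcount, hvol, Finset.sum_sub_distrib, Finset.mul_sum]
    push_cast
    simp only [mul_one_div]
  rw [hsum] at hM
  have hKcard : ((m : ℝ) / u₀) ^ s ≤ K.card := by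
    rw [hK, Fintype.card_piFinset]
    push_cast
    calc ((m : ℝ) / u₀) ^ s = ∏ _i : Fin s, (m : ℝ) / u₀ := by
          rw [Finset.prod_const, Finset.card_univ, Fintype.card_fin]
      _ ≤ _ := Finset.prod_le_prod (fun i _ => by positivity) fun i _ => by
        refine le_trans ?_ (hRcard i)
        have h1 : (0 : ℝ) < u i := by exact_mod_cast hu0 i
        have h2 : (u i : ℝ) ≤ u₀ := by exact_mod_cast huu₀ i
        gcongr
  have hKpos : (0 : ℝ) < K.card := by
    refine lt_of_lt_of_le ?_ hKcard
    positivity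
  have hM1 : 1 ≤ M := by
    by_contra h0
    obtain rfl : M = 0 := by omega
    have h1 : (0 : ℝ) < K.card * (1 / (4 * (U : ℝ))) / 2 := by positivity
    refine absurd (h1.trans_le hM) ?_
    simp
  have hUcast : ∏ i, (u i : ℝ) = U := by rw [hU, Nat.cast_prod]
  rw [hUcast]
  calc _ ≤ (K.card : ℝ) * (1 / (4 * (U : ℝ))) / 2 :=
        constant_mul_log_pow_le (by omega) (by exact_mod_cast hu₀2) (by exact_mod_cast hU0)
          (Real.log_natCast_nonneg N) hmlog hKcard
    _ ≤ _ := hM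
    _ ≤ _ := abs_count_sub_le_mul_starDisc hM1 (fun n i => ratPhiTrunc (u i) (v i) (σ i) t n) hy
    _ ≤ _ := le_sSup_mul_starDisc hM1 (by omega) _
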